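/- For every integer k ≥ 1, setting m = 2k+1, the following identity holds in the field ℚ(a,q,t): (−aqt)^{m−1} · (1 − q^{−2}t^{−2})/(1 − q^{−4}t^{−2}) · [ (1 + a²q^{−2}t)/(1 − q^{−2}t^{−2}) + q^{−2m}(−t)^{2−m} · (a² + q^{−2}t^{−3})/(1 − q^{−2}t^{−2}) ] = 𝒫₂(k), where 𝒫₂(k) = Σ_{i=0}^{k} a^{2k} q^{4i−2k} t^{2i} + Σ_{i=1}^{k} a^{2k+2} q^{4i−2k−2} t^{2i+1}. -/

import Mathlib

noncomputable section
open Finset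

/-- The field of rational functions `ℚ(a,q,t)`. -/
abbrev K := FractionRing (MvPolynomial (Fin 3) ℚ)

/-- The indeterminate `a`. -/
def a : K := algebraMap (MvPolynomial (Fin 3) ℚ) K (MvPolynomial.X 0)

/-- The indeterminate `q`. -/
def q : K := algebraMap (MvPolynomial (Fin 3) ℚ) K (MvPolynomial.X 1)

/-- The indeterminate `t`. -/
def t : K := algebraMap (MvPolynomial (Fin 3) ℚ) K (MvPolynomial.X 2)

theorem q_pow_mul_t_pow_ne_one (m : ℕ) {n : ℕ} (hn : n ≠ 0) : q ^ m * t ^ n ≠ 1 := by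
  intro h
  have h' : (MvPolynomial.X 1 ^ m * MvPolynomial.X 2 ^ n : MvPolynomial (Fin 3) ℚ) = 1 := by
    apply IsFractionRing.injective (MvPolynomial (Fin 3) ℚ) K
    simpa [q, t] using h
  simpa [hn] using congrArg (MvPolynomial.eval 0) h'

theorem q_ne_zero : q ≠ 0 := by simp [q]

theorem t_ne_zero : t ≠ 0 := by simp [t]

/-- The first sum in `𝒫₂(k)` is geometric with ratio `q⁴t²`. -/
theorem sum_range_superpolynomial {F : Type*} [Field F] (a : F) {q t : F} (hq : q ≠ 0)
    (hx : q ^ 4 * t ^ 2 ≠ 1) (k : ℕ) :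
    ∑ i ∈ range (k + 1), a ^ (2 * k) * q ^ (4 * (i : ℤ) - 2 * k) * t ^ (2 * i) =
      a ^ (2 * k) / q ^ (2 * k) * (((q ^ 4 * t ^ 2) ^ (k + 1) - 1) / (q ^ 4 * t ^ 2 - 1)) := by
  rw [← geom_sum_eq hx, mul_sum]
  refine sum_congr rfl fun i _ => ?_
  rw [zpow_sub₀ hq, mul_pow, ← pow_mul, ← pow_mul]
  norm_cast
  ring

/-- The second sum in `𝒫₂(k)` is geometric with ratio `q⁴t²`. -/
theorem sum_Icc_superpolynomial {F : Type*} [Field F] (a : F) {q t : F} (hq : q ≠ 0)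
    (hx : q ^ 4 * t ^ 2 ≠ 1) (k : ℕ) :
    ∑ i ∈ Icc 1 k, a ^ (2 * k + 2) * q ^ (4 * (i : ℤ) - 2 * k - 2) * t ^ (2 * i + 1) =
      a ^ (2 * k + 2) * q ^ 2 * t ^ 3 / q ^ (2 * k) *
        (((q ^ 4 * t ^ 2) ^ k - 1) / (q ^ 4 * t ^ 2 - 1)) := by
  rw [← geom_sum_eq hx, mul_sum, range_eq_Ico, sum_Ico_eq_sum_range, ← Ico_add_one_right_eq_Icc,
    sum_Ico_eq_sum_range]
  refine sum_congr (by simp) fun i _ => ?_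
  have e : 4 * ((1 + i : ℕ) : ℤ) - 2 * k - 2 = ((4 * i + 2 : ℕ) : ℤ) - ((2 * k : ℕ) : ℤ) := by
    push_cast
    ring
  rw [e, zpow_sub₀ hq, zpow_natCast, zpow_natCast]
  ring

/-- For `m = 2k+1`, Jones' formula with powers of `(-t)` inserted
equals the reduced superpolynomial `𝒫₂(k)` of the `(2,2k+1)` torus knot, as an
identity in `ℚ(a,q,t)`. -/
theorem statement_4 (k : ℕ) (hk : 1 ≤ k) (m : ℕ) (hm : m = 2 * k + 1) :
    (-(a * q * t)) ^ (m - 1) *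
        ((1 - q ^ (-2 : ℤ) * t ^ (-2 : ℤ)) / (1 - q ^ (-4 : ℤ) * t ^ (-2 : ℤ))) *
      ((1 + a ^ 2 * q ^ (-2 : ℤ) * t) / (1 - q ^ (-2 : ℤ) * t ^ (-2 : ℤ))
        + q ^ (-(2 * (m : ℤ))) * (-t) ^ ((2 : ℤ) - m) *
            ((a ^ 2 + q ^ (-2 : ℤ) * t ^ (-3 : ℤ)) / (1 - q ^ (-2 : ℤ) * t ^ (-2 : ℤ))))
    = ∑ i ∈ range (k + 1), a ^ (2 * k) * q ^ (4 * (i : ℤ) - 2 * k) * t ^ (2 * i)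
      + ∑ i ∈ Icc 1 k, a ^ (2 * k + 2) * q ^ (4 * (i : ℤ) - 2 * k - 2) * t ^ (2 * i + 1) := by
  subst hm
  have hq := q_ne_zero
  have ht := t_ne_zero
  have hx := q_pow_mul_t_pow_ne_one 4 two_ne_zero
  have hy := q_pow_mul_t_pow_ne_one 2 two_ne_zero
  rw [sum_range_superpolynomial a hq hx, sum_Icc_superpolynomial a hq hx]
  have hx' : q ^ 4 * t ^ 2 - 1 ≠ 0 := sub_ne_zero.mpr hx
  have hy' : q ^ 2 * t ^ 2 - 1 ≠ 0 := sub_ne_zero.mpr hy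
  have e₁ : q ^ (-(2 * ((2 * k + 1 : ℕ) : ℤ))) = 1 / (q ^ 2 * (q ^ k) ^ 4) := by
    rw [zpow_neg, one_div, ← pow_mul, ← pow_add, ← zpow_natCast]
    congr 2
    push_cast
    ring
  have e₂ : (-t) ^ ((2 : ℤ) - (2 * k + 1 : ℕ)) = -t / (t ^ k) ^ 2 := by
    have e : (2 : ℤ) - (2 * k + 1 : ℕ) = 1 - ((2 * k : ℕ) : ℤ) := by
      push_cast
      ring
    rw [e, zpow_sub₀ (neg_ne_zero.mpr ht), zpow_one, zpow_natCast, (even_two_mul k).neg_pow]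
    ring
  have e₃ : (-(a * q * t)) ^ (2 * k + 1 - 1) = (a ^ k) ^ 2 * (q ^ k) ^ 2 * (t ^ k) ^ 2 := by
    rw [Nat.add_sub_cancel, (even_two_mul k).neg_pow]
    ring
  have e₄ : 1 - q ^ (-2 : ℤ) * t ^ (-2 : ℤ) = (q ^ 2 * t ^ 2 - 1) / (q ^ 2 * t ^ 2) := by
    field_simp
  have e₅ : 1 - q ^ (-4 : ℤ) * t ^ (-2 : ℤ) = (q ^ 4 * t ^ 2 - 1) / (q ^ 4 * t ^ 2) := by
    field_simp
  have e₆ : q ^ (-2 : ℤ) = 1 / q ^ 2 := by field_simp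
  have e₇ : t ^ (-3 : ℤ) = 1 / t ^ 3 := by field_simp
  have hQ : q ^ k ≠ 0 := pow_ne_zero k hq
  have hT : t ^ k ≠ 0 := pow_ne_zero k ht
  have e₈ : (q ^ 4 * t ^ 2) ^ k = (q ^ k) ^ 4 * (t ^ k) ^ 2 := by ring
  rw [e₁, e₂, e₃, e₄, e₅, e₆, e₇, pow_succ (q ^ 4 * t ^ 2), e₈, pow_add a, mul_comm 2 k,
    pow_mul a, pow_mul q]
  generalize q ^ k = Q at *
  generalize t ^ k = T at *
  generalize a ^ k = A at *
  field_simp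
  ring
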